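/- Let f be a nonnegative monotone k-submodular function on 𝒮 with f(∅) = 0, and let S ∈ 𝒮 be greedy-consistent, i.e., there is an ordering (b_1,j_1),…,(b_m,j_m) of the pairs of S such that for each τ ∈ [m], the index j_τ maximizes Δ_{b_τ, i}(S^{τ−1}) over i ∈ [k], where S^{τ−1} = {(b_1,j_1),…,(b_{τ−1},j_{τ−1})}. Then for every T ∈ 𝒮 one has f(T) ≤ 2·( f(S) + Σ_{a ∈ U(T)∖U(S)} max_{i∈[k]} Δ_{a,i}(S) ). -/

import Mathlib

/-!  Common setup: a `k`-disjoint solution over a ground set `V` is encoded as a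
function `V → Option (Fin k)`, where `x a = some i` means item `a` lies in the
`i`-th set `X_i`, and `x a = none` means `a` is not selected.  -/

/-- The operation `x ⊔ y`: item `a` keeps label `i` iff all labels assigned to `a`
by `x` and `y` equal `i`. -/
def ksup {V : Type*} {k : ℕ} (x y : V → Option (Fin k)) : V → Option (Fin k) :=
  fun a =>
    match x a, y a with
    | none, o => o
    | some i, none => some i
    | some i, some j => if i = j then some i else none

/-- The operation `x ⊓ y`: componentwise intersection. -/
def kinf {V : Type*} {k : ℕ} (x y : V → Option (Fin k)) : V → Option (Fin k) :=
  fun a => if x a = y a then x a else none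

/-- `f` is `k`-submodular. -/
def KSubmodular {V : Type*} {k : ℕ} (f : (V → Option (Fin k)) → ℝ) : Prop :=
  ∀ x y, f (ksup x y) + f (kinf x y) ≤ f x + f y

/-- `f` is monotone: enlarging each component (keeping labels) does not decrease `f`. -/
def KMonotone {V : Type*} {k : ℕ} (f : (V → Option (Fin k)) → ℝ) : Prop :=
  ∀ x y : V → Option (Fin k), (∀ a i, x a = some i → y a = some i) → f x ≤ f y

/-- Diminishing returns of a `k`-submodular function: assigning the label `o` to an unselected
item gains at most as much over `y` as over any `x` contained in `y`. -/
theorem KSubmodular.marginal_le {V : Type*} [DecidableEq V] {k : ℕ}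
    {f : (V → Option (Fin k)) → ℝ} (hsub : KSubmodular f) {x y : V → Option (Fin k)}
    (hxy : ∀ a i, x a = some i → y a = some i) {a : V} (ha : y a = none) (o : Option (Fin k)) :
    f (Function.update y a o) + f x ≤ f (Function.update x a o) + f y := by
  have hxa : x a = none := by
    cases h : x a with
    | none => rfl
    | some i => simp [hxy a i h] at ha
  have hsup : ksup (Function.update x a o) y = Function.update y a o := by
    funext c
    rcases eq_or_ne c a with rfl | hc
    · cases o <;> simp [ksup, ha]
    · cases h : x c with
      | none => simp [ksup, hc, h]
      | some i => simp [ksup, hc, h, hxy c i h]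
  have hinf : kinf (Function.update x a o) y = x := by
    funext c
    rcases eq_or_ne c a with rfl | hc
    · cases o <;> simp [kinf, ha, hxa]
    · cases h : x c with
      | none => simp [kinf, hc, h]
      | some i => simp [kinf, hc, h, hxy c i h]
  simpa only [hsup, hinf] using hsub (Function.update x a o) y

/-- Adding the labels of `T` on a set `A` of items unselected by `S` gains at most the sum of the
individual marginal gains over `S`. -/
theorem KSubmodular.le_add_sum_marginal {V : Type*} [DecidableEq V] {k : ℕ}
    {f : (V → Option (Fin k)) → ℝ} (hsub : KSubmodular f) (S T : V → Option (Fin k))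
    (A : Finset V) (hA : ∀ a ∈ A, S a = none) :
    f (A.piecewise T S) ≤ f S + ∑ a ∈ A, (f (Function.update S a (T a)) - f S) := by
  induction A using Finset.induction_on with
  | empty => simp
  | insert a A ha ih =>
    rw [Finset.sum_insert ha, Finset.piecewise_insert]
    have hle : ∀ c i, S c = some i → A.piecewise T S c = some i := by
      intro c i hc
      have hcA : c ∉ A := fun h => by simp [hA c (Finset.mem_insert_of_mem h)] at hc
      simpa [hcA] using hc
    have hnone : A.piecewise T S a = none := by
      simpa [ha] using hA a (Finset.mem_insert_self a A)
    have := hsub.marginal_le hle hnone (T a)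
    have := ih fun c hc => hA c (Finset.mem_insert_of_mem hc)
    linarith

/-- Replacing the label that `T` gives to an item by a label of maximum marginal gain over `x`
loses at most that gain. -/
theorem KSubmodular.or_le_or_update_add {V : Type*} [DecidableEq V] {k : ℕ}
    {f : (V → Option (Fin k)) → ℝ} (hsub : KSubmodular f) (hmono : KMonotone f)
    {x : V → Option (Fin k)} (T : V → Option (Fin k)) {a : V} (ha : x a = none) {j : Fin k}
    (hj : ∀ i, f (Function.update x a (some i)) ≤ f (Function.update x a (some j))) :
    f (fun c => (x c).or (T c)) ≤ f (fun c => (Function.update x a (some j) c).or (T c)) +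
      (f (Function.update x a (some j)) - f x) := by
  let R : V → Option (Fin k) := Function.update (fun c => (x c).or (T c)) a none
  have hxR : ∀ c i, x c = some i → R c = some i := by
    intro c i hc
    have hca : c ≠ a := by
      rintro rfl
      simp [ha] at hc
    simp [R, hca, hc]
  have hadd : Function.update R a (T a) = fun c => (x c).or (T c) := by
    funext c
    rcases eq_or_ne c a with rfl | hc <;> simp [R, *]
  have hgain : f (Function.update x a (T a)) ≤ f (Function.update x a (some j)) := by
    cases T a with
    | some i => exact hj i
    | none =>
      refine hmono _ _ fun c i hc => ?_
      rcases eq_or_ne c a with rfl | hca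
      · simp at hc
      · simpa [hca] using hc
  have hR : f R ≤ f (fun c => (Function.update x a (some j) c).or (T c)) := by
    refine hmono _ _ fun c i hc => ?_
    rcases eq_or_ne c a with rfl | hca
    · simp [R] at hc
    · simpa [R, hca] using hc
  have hdim := hsub.marginal_le hxR (by simp [R] : R a = none) (T a)
  rw [hadd] at hdim
  linarith

/-- If `S` is a greedy-consistent solution (its pairs `(b τ, jdx τ)`, `τ < m`, can be
ordered so that each index `jdx τ` maximizes the marginal gain of item `b τ` with
respect to the prefix `Sseq τ`), then for every solution `T`,
`f(T) ≤ 2·(f(S) + Σ_{a ∈ U(T)∖U(S)} max_{i∈[k]} Δ_{a,i}(S))`. -/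
theorem greedy_consistent_bound {V : Type*} [Fintype V] [DecidableEq V]
    {k : ℕ} (hk : 0 < k)
    (f : (V → Option (Fin k)) → ℝ)
    (hsub : KSubmodular f) (hmono : KMonotone f) (hnn : ∀ x, 0 ≤ f x)
    (hzero : f (fun _ => none) = 0)
    (m : ℕ) (b : ℕ → V) (jdx : ℕ → Fin k)
    (hinj : ∀ s t, s < m → t < m → b s = b t → s = t)
    (Sseq : ℕ → V → Option (Fin k))
    (hS0 : Sseq 0 = fun _ => none)
    (hstep : ∀ τ < m, Sseq (τ + 1) = Function.update (Sseq τ) (b τ) (some (jdx τ)))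
    (hgreedy : ∀ τ < m, ∀ i : Fin k,
      f (Function.update (Sseq τ) (b τ) (some i)) ≤
        f (Function.update (Sseq τ) (b τ) (some (jdx τ))))
    (S : V → Option (Fin k)) (hS : S = Sseq m)
    (T : V → Option (Fin k)) :
    f T ≤ 2 * (f S +
      ∑ a ∈ Finset.univ.filter (fun a => T a ≠ none ∧ S a = none),
        Finset.univ.sup' (Finset.univ_nonempty_iff.mpr (Fin.pos_iff_nonempty.mp hk))
          (fun i : Fin k => f (Function.update S a (some i)) - f S)) := by
  have hsupp : ∀ τ ≤ m, ∀ c, Sseq τ c ≠ none → ∃ s < τ, b s = c := by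
    intro τ
    induction τ with
    | zero => simp [hS0]
    | succ τ ih =>
      intro hτ c hc
      rw [hstep τ hτ] at hc
      rcases eq_or_ne c (b τ) with rfl | hcb
      · exact ⟨τ, τ.lt_succ_self, rfl⟩
      · obtain ⟨s, hs, hsc⟩ := ih (by omega) c (by simpa [hcb] using hc)
        exact ⟨s, by omega, hsc⟩
  have hfresh : ∀ τ < m, Sseq τ (b τ) = none := by
    intro τ hτ
    by_contra h
    obtain ⟨s, hs, hsb⟩ := hsupp τ hτ.le _ h
    exact hs.ne (hinj s τ (hs.trans hτ) hτ hsb)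
  have hexchange : ∀ τ ≤ m, f T ≤ f (fun c => (Sseq τ c).or (T c)) + f (Sseq τ) := by
    intro τ
    induction τ with
    | zero => simp [hS0, hzero]
    | succ τ ih =>
      intro hτ
      have hprev := ih (by omega)
      have hswap := hsub.or_le_or_update_add hmono T (hfresh τ hτ) (hgreedy τ hτ)
      rw [← hstep τ hτ] at hswap
      linarith
  have hT := hexchange m le_rfl
  rw [← hS] at hT
  set A := Finset.univ.filter (fun a => T a ≠ none ∧ S a = none)
  have hor : (fun c => (S c).or (T c)) = A.piecewise T S := by
    funext c
    cases hs : S c <;> cases ht : T c <;> simp [A, Finset.piecewise, hs, ht]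
  have hadd := hsub.le_add_sum_marginal S T A fun a ha => (Finset.mem_filter.mp ha).2.2
  rw [← hor] at hadd
  have hmax : ∀ a ∈ A, f (Function.update S a (T a)) - f S ≤
      Finset.univ.sup' (Finset.univ_nonempty_iff.mpr (Fin.pos_iff_nonempty.mp hk))
        (fun i : Fin k => f (Function.update S a (some i)) - f S) := by
    intro a ha
    obtain ⟨i, hi⟩ := Option.ne_none_iff_exists'.mp (Finset.mem_filter.mp ha).2.1
    rw [hi]
    exact Finset.le_sup' (fun i : Fin k => f (Function.update S a (some i)) - f S)
      (Finset.mem_univ i)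
  have hnonneg : ∀ a ∈ A, 0 ≤ f (Function.update S a (T a)) - f S := by
    intro a ha
    refine sub_nonneg.mpr (hmono _ _ fun c i hc => ?_)
    have hca : c ≠ a := by
      rintro rfl
      simp [(Finset.mem_filter.mp ha).2.2] at hc
    simpa [hca] using hc
  have := Finset.sum_le_sum hmax
  have := Finset.sum_nonneg hnonneg
  linarith
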